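/- For every real η > 1, define t(η) = (e/(e−1)) · η^η/(η+1)^{η+1}. Then the MaxExp function is an upper bound of the Heat Diffusion Process kernel: for all λ ∈ (0, 1], 1 − (1 − λ)^η ≥ exp(−t(η)/λ). -/

import Mathlib

/-- The chord of `x ↦ exp (-x)` over `[0, 1]` lies above the graph. -/
lemma exp_neg_le_chord {z : ℝ} (h0 : 0 ≤ z) (h1 : z ≤ 1) :
    Real.exp (-z) ≤ 1 - (Real.exp 1 - 1) / Real.exp 1 * z := by
  have h := convexOn_exp.2 (Set.mem_univ 0) (Set.mem_univ (-1)) (sub_nonneg.2 h1) h0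
    (sub_add_cancel 1 z)
  simp only [smul_eq_mul, mul_zero, zero_add, mul_neg, mul_one, Real.exp_zero, Real.exp_neg 1] at h
  have he : (Real.exp 1 - 1) / Real.exp 1 = 1 - (Real.exp 1)⁻¹ := by
    field_simp
  rw [he]
  linarith

/-- The maximum of `x * (1 - x) ^ η` over `[0, 1]` is attained at `x = 1 / (η + 1)`. -/
lemma mul_one_sub_rpow_le {η x : ℝ} (hη : 0 < η) (h0 : 0 ≤ x) (h1 : x ≤ 1) :
    x * (1 - x) ^ η ≤ η ^ η / (η + 1) ^ (η + 1) := by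
  have hη1 : 0 < η + 1 := by linarith
  have h1x : 0 ≤ 1 - x := sub_nonneg.2 h1
  have hp : 0 ≤ x * (η + 1) := by positivity
  have hq : 0 ≤ (1 - x) * (η + 1) / η := by positivity
  have amgm := Real.geom_mean_le_arith_mean2_weighted (w₁ := 1 / (η + 1)) (w₂ := η / (η + 1))
    (by positivity) (by positivity) hp hq (by field_simp; ring)
  have hsum : 1 / (η + 1) * (x * (η + 1)) + η / (η + 1) * ((1 - x) * (η + 1) / η) = 1 := by
    field_simp
    ring
  rw [hsum] at amgm
  have hpow := Real.rpow_le_rpow (by positivity) amgm hη1.le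
  rw [Real.one_rpow, Real.mul_rpow (by positivity) (by positivity), ← Real.rpow_mul hp,
    ← Real.rpow_mul hq, div_mul_cancel₀ _ hη1.ne', div_mul_cancel₀ _ hη1.ne', Real.rpow_one,
    Real.div_rpow (by positivity) hη.le, Real.mul_rpow h1x hη1.le] at hpow
  have hηη : 0 < η ^ η := by positivity
  rw [le_div_iff₀ (by positivity), Real.rpow_add_one hη1.ne']
  have key : x * (η + 1) * ((1 - x) ^ η * (η + 1) ^ η / η ^ η) * η ^ η ≤ 1 * η ^ η := by gcongr
  calc x * (1 - x) ^ η * ((η + 1) ^ η * (η + 1))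
      = x * (η + 1) * ((1 - x) ^ η * (η + 1) ^ η / η ^ η) * η ^ η := by field_simp
    _ ≤ η ^ η := by linarith

/-- MaxExp lies above its chord from the origin. -/
lemma mul_one_sub_one_sub_rpow_le {η s t : ℝ} (hη : 1 ≤ η) (hs0 : 0 ≤ s) (hs1 : s ≤ 1)
    (ht : t ≤ 1) : s * (1 - (1 - t) ^ η) ≤ 1 - (1 - s * t) ^ η := by
  have h := (convexOn_rpow hη).2 (Set.mem_Ici.2 zero_le_one) (Set.mem_Ici.2 (sub_nonneg.2 ht))
    (sub_nonneg.2 hs1) hs0 (sub_add_cancel 1 s)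
  simp only [smul_eq_mul, Real.one_rpow] at h
  rw [show (1 - s) * 1 + s * (1 - t) = 1 - s * t by ring] at h
  linarith

/-- Theorem 4 (main inequality): with `t(η) = (e/(e-1)) η^η/(η+1)^{η+1}`,
MaxExp is an upper bound of the HDP kernel: for all `λ ∈ (0,1]`,
`1 - (1-λ)^η ≥ exp(-t(η)/λ)`. -/
theorem maxExp_upper_bound_of_HDP (η : ℝ) (hη : 1 < η) (lam : ℝ)
    (hlam : lam ∈ Set.Ioc (0 : ℝ) 1) :
    Real.exp (-((Real.exp 1 / (Real.exp 1 - 1)) * η ^ η / (η + 1) ^ (η + 1)) / lam)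
      ≤ 1 - (1 - lam) ^ η := by
  obtain ⟨hl0, hl1⟩ := hlam
  have hη0 : 0 < η := by linarith
  have he : 2 ≤ Real.exp 1 := by linarith [Real.add_one_le_exp 1]
  have he1 : 0 < Real.exp 1 - 1 := by linarith
  set M := η ^ η / (η + 1) ^ (η + 1) with hM
  have hM0 : 0 < M := by positivity
  have hM2 : M ≤ 1 / 2 := by
    rw [hM, Real.rpow_add_one (by positivity), div_le_div_iff₀ (by positivity) two_pos]
    have h : η ^ η ≤ (η + 1) ^ η := by gcongr; linarith
    nlinarith [Real.rpow_pos_of_pos hη0 η]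
  rw [mul_div_assoc, ← hM]
  set t := Real.exp 1 / (Real.exp 1 - 1) * M with ht
  have ht0 : 0 < t := by positivity
  have ht1 : t ≤ 1 := by
    rw [ht, div_mul_eq_mul_div, div_le_one he1]
    nlinarith
  have large : ∀ x, t ≤ x → x ≤ 1 → Real.exp (-(t / x)) ≤ 1 - (1 - x) ^ η := by
    intro x htx hx1
    have hx0 : 0 < x := ht0.trans_le htx
    have hchord := exp_neg_le_chord (by positivity) ((div_le_one hx0).2 htx)
    have hmax : (1 - x) ^ η ≤ M / x := by
      rw [le_div_iff₀ hx0, mul_comm]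
      exact mul_one_sub_rpow_le hη0 hx0.le hx1
    have heq : (Real.exp 1 - 1) / Real.exp 1 * (t / x) = M / x := by
      rw [ht]
      field_simp
    linarith
  rw [neg_div]
  rcases le_total t lam with h | h
  · exact large lam h hl1
  · have hconc := mul_one_sub_one_sub_rpow_le hη.le (s := lam / t) (by positivity)
      ((div_le_one ht0).2 h) ht1
    rw [div_mul_cancel₀ _ ht0.ne'] at hconc
    refine le_trans ?_ ((mul_le_mul_of_nonneg_left (large t le_rfl ht1) (by positivity)).trans hconc)
    rw [div_self ht0.ne', ← inv_div t lam, inv_mul_eq_div, le_div_iff₀ (by positivity)]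
    have hexp : t / lam ≤ Real.exp (t / lam - 1) := by
      linarith [Real.add_one_le_exp (t / lam - 1)]
    calc Real.exp (-(t / lam)) * (t / lam)
        ≤ Real.exp (-(t / lam)) * Real.exp (t / lam - 1) := by gcongr
      _ = Real.exp (-1) := by rw [← Real.exp_add]; ring_nf
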